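/- arXiv:1607.01311 — 3 statements merged into one kernel-verified Lean document; each statement's English description precedes it below -/
import Mathlib

section
/- For every integer n ≥ 1, the polynomials P_n(x,y,q) satisfy P_{n+1}(x,y,q) = (2nx + qy)·P_n(x,y,q) + 2x(1−x)·∂P_n/∂x + 2x(1−y)·∂P_n/∂y. -/
open scoped Classical
noncomputable section

/-- The multiset `{1,1,2,2,…,n,n}` as a list. -/
def baseList (n : ℕ) : List ℕ := (List.range n).flatMap (fun i => [i + 1, i + 1])

/-- A word is Stirling if whenever the same value occurs at positions `i < k`,
every entry strictly between them is greater than that value. -/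
def IsStirlingWord (l : List ℕ) : Prop :=
  ∀ i j k : Fin l.length, i < j → j < k → l.get i = l.get k → l.get i < l.get j

/-- The set `Q_n` of Stirling permutations of order `n`:  rearrangements of the
multiset `{1,1,2,2,…,n,n}` in which all entries between the two occurrences of any
value exceed that value. -/
def stirlingPerms (n : ℕ) : Finset (List ℕ) :=
  ((baseList n).permutations.toFinset).filter IsStirlingWord

/-- Number of descents of `σ ∈ Q_n`: indices `i ∈ {1,…,2n}` (here 0-based) with
`σ_i > σ_{i+1}`, with the convention `σ_{2n+1} = 0`. -/
def desList (l : List ℕ) : ℕ :=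
  ((Finset.range l.length).filter (fun i => l.getD (i + 1) 0 < l.getD i 0)).card

/-- The second-order Eulerian polynomial `C_n(x) = ∑_{σ ∈ Q_n} x^{des σ}`. -/
def Cpoly (n : ℕ) : Polynomial ℚ :=
  ∑ σ ∈ stirlingPerms n, Polynomial.X ^ desList σ

/-- A list of cycles is a valid standard cycle form of a Stirling permutation of the
second kind of order `n` if:  the cycles are disjoint and together use each of
`1,1,2,2,…,n,n` exactly once; both copies of any value lie in the same cycle; each
cycle starts with (one of) its smallest entries; the cycles are listed in increasing
order of their smallest (first) entries; and the word of each cycle reduces to a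
Stirling permutation. -/
def IsStirling2 (n : ℕ) (c : List (List ℕ)) : Prop :=
  c.flatten.Perm (baseList n) ∧
  (∀ w ∈ c, w ≠ [] ∧ (∀ v ∈ w, w.count v = 2) ∧ (∀ v ∈ w, w.headI ≤ v) ∧
      IsStirlingWord w) ∧
  c.Chain' (fun w₁ w₂ => w₁.headI < w₂.headI)

/-- The set `Q_n²` of Stirling permutations of the second kind of order `n`,
each recorded as its standard cycle form (a list of cycles). -/
def stirling2 (n : ℕ) : Finset (List (List ℕ)) :=
  ((((baseList n).permutations.toFinset) ×ˢ (Finset.univ : Finset (Composition (2 * n)))).image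
      (fun p => p.1.splitWrtComposition p.2)).filter (IsStirling2 n)

/-- `cyc(σ)`: the number of cycles. -/
def cyc (c : List (List ℕ)) : ℕ := c.length

/-- `cplat(σ)`: the number of cycle plateaus, i.e. entries `c_i` of a cycle
`(c_1,…,c_{2k})` with `c_i = c_{i+1}`, `1 ≤ i < 2k`. -/
def cplat (c : List (List ℕ)) : ℕ :=
  (c.map (fun w => ((Finset.range w.length).filter
    (fun i => i + 1 < w.length ∧ w.getD i 0 = w.getD (i + 1) 0)).card)).sum

/-- `casc(σ)`: the number of cycle ascents, i.e. entries `c_i` of a cycle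
`(c_1,…,c_{2k})` with `c_i < c_{i+1}`, `1 ≤ i < 2k`. -/
def casc (c : List (List ℕ)) : ℕ :=
  (c.map (fun w => ((Finset.range w.length).filter
    (fun i => i + 1 < w.length ∧ w.getD i 0 < w.getD (i + 1) 0)).card)).sum

/-- `cap(σ)`: the number of cycle ascent plateaus, i.e. entries `c_i` of a cycle
`(c_1,…,c_{2k})` with `c_{i-1} < c_i = c_{i+1}`, `2 ≤ i ≤ 2k-1`. -/
def capSt (c : List (List ℕ)) : ℕ :=
  (c.map (fun w => ((Finset.range w.length).filter
    (fun i => 0 < i ∧ i + 1 < w.length ∧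
      w.getD (i - 1) 0 < w.getD i 0 ∧ w.getD i 0 = w.getD (i + 1) 0)).card)).sum

/-- `fix(σ)`: the number of fixed points, i.e. values `k` with `(k,k)` a cycle of `σ`. -/
def fixSt (c : List (List ℕ)) : ℕ :=
  ((Finset.range c.length).filter (fun i => ∃ k : ℕ, c.getD i [] = [k, k])).card

open MvPolynomial in
/-- `P_n(x,y,q) = ∑_{σ ∈ Q_n²} x^{cap(σ)} y^{fix(σ)} q^{cyc(σ)}`, as a polynomial in the
three variables `x = X 0`, `y = X 1`, `q = X 2`. -/
def Pmv (n : ℕ) : MvPolynomial (Fin 3) ℚ :=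
  ∑ σ ∈ stirling2 n, X 0 ^ capSt σ * X 1 ^ fixSt σ * X 2 ^ cyc σ

/-- All words obtained from `w` by inserting `N N` right after one of its entries. -/
def wordInsertions (N : ℕ) : List ℕ → List (List ℕ)
  | [] => []
  | a :: w => (a :: N :: N :: w) :: (wordInsertions N w).map (a :: ·)

/-- All lists of cycles obtained from `c` by inserting `N N` right after an entry of some
cycle, or by appending the new cycle `(N, N)`. -/
def cycleInsertions (N : ℕ) : List (List ℕ) → List (List (List ℕ))
  | [] => [[[N, N]]]
  | w :: c => (wordInsertions N w).map (· :: c) ++ (cycleInsertions N c).map (w :: ·)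

/-- The number of ascent plateaus of a word. -/
def wordCap : List ℕ → ℕ
  | a :: b :: c :: l => (if a < b ∧ b = c then 1 else 0) + wordCap (b :: c :: l)
  | _ => 0

/-- Removes all occurrences of `N`, and the cycles that become empty. -/
def removeLetter (N : ℕ) (c : List (List ℕ)) : List (List ℕ) :=
  (c.map (List.filter (· ≠ N))).filter (· ≠ [])

theorem mem_wordInsertions {N : ℕ} {w w' : List ℕ} :
    w' ∈ wordInsertions N w ↔ ∃ u v, u ≠ [] ∧ w = u ++ v ∧ w' = u ++ N :: N :: v := by
  induction w generalizing w' with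
  | nil => simp [wordInsertions]
  | cons a w ih =>
    simp only [wordInsertions, List.mem_cons, List.mem_map, ih]
    constructor
    · rintro (rfl | ⟨_, ⟨u, v, hu, rfl, rfl⟩, rfl⟩)
      · exact ⟨[a], w, by simp⟩
      · exact ⟨a :: u, v, by simp⟩
    · rintro ⟨u, v, hu, h, rfl⟩
      obtain _ | ⟨b, u⟩ := u
      · simp at hu
      · simp only [List.cons_append, List.cons.injEq] at h
        obtain ⟨rfl, rfl⟩ := h
        obtain _ | ⟨d, u⟩ := u
        · simp
        · exact Or.inr ⟨_, ⟨d :: u, v, by simp, rfl, rfl⟩, rfl⟩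

theorem mem_cycleInsertions {N : ℕ} {c σ : List (List ℕ)} :
    σ ∈ cycleInsertions N c ↔ σ = c ++ [[N, N]] ∨
      ∃ A u v B, u ≠ [] ∧ c = A ++ (u ++ v) :: B ∧ σ = A ++ (u ++ N :: N :: v) :: B := by
  induction c generalizing σ with
  | nil => simp [cycleInsertions]
  | cons w c ih =>
    simp only [cycleInsertions, List.mem_append, List.mem_map, ih, mem_wordInsertions]
    constructor
    · rintro (⟨_, ⟨u, v, hu, rfl, rfl⟩, rfl⟩ | ⟨_, (rfl | ⟨A, u, v, B, hu, rfl, rfl⟩), rfl⟩)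
      · exact Or.inr ⟨[], u, v, c, by simp [hu]⟩
      · simp
      · exact Or.inr ⟨w :: A, u, v, B, by simp [hu]⟩
    · rintro (rfl | ⟨A, u, v, B, hu, h, rfl⟩)
      · exact Or.inr ⟨_, Or.inl rfl, rfl⟩
      · obtain _ | ⟨w', A⟩ := A
        · simp only [List.nil_append, List.cons.injEq] at h
          obtain ⟨rfl, rfl⟩ := h
          exact Or.inl ⟨_, ⟨u, v, hu, rfl, rfl⟩, rfl⟩
        · simp only [List.cons_append, List.cons.injEq] at h
          obtain ⟨rfl, rfl⟩ := h
          exact Or.inr ⟨_, Or.inr ⟨A, u, v, B, hu, rfl, rfl⟩, rfl⟩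

theorem nodup_wordInsertions {N : ℕ} {w : List ℕ} (h : N ∉ w) : (wordInsertions N w).Nodup := by
  induction w with
  | nil => simp [wordInsertions]
  | cons a w ih =>
    rw [List.mem_cons, not_or] at h
    rw [wordInsertions, List.nodup_cons]
    refine ⟨?_, (ih h.2).map (List.cons_injective)⟩
    simp only [List.mem_map, List.cons.injEq, true_and, exists_eq_right, mem_wordInsertions]
    rintro ⟨_ | ⟨b, u⟩, v, hu, rfl, h'⟩
    · simp at hu
    · simp only [List.cons_append, List.cons.injEq] at h'
      simp [← h'.1] at h

theorem nodup_cycleInsertions {N : ℕ} {c : List (List ℕ)} (h : ∀ w ∈ c, N ∉ w) :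
    (cycleInsertions N c).Nodup := by
  induction c with
  | nil => simp [cycleInsertions]
  | cons w c ih =>
    rw [cycleInsertions, List.nodup_append]
    refine ⟨(nodup_wordInsertions (h w (by simp))).map fun a b hab => by simpa using hab,
      (ih fun w hw => h w (by simp [hw])).map List.cons_injective, ?_⟩
    simp only [List.mem_map, mem_wordInsertions]
    rintro _ ⟨_, ⟨u, v, hu, rfl, rfl⟩, rfl⟩ _ ⟨_, _, rfl⟩ heq
    have := congrArg List.length (List.cons.inj heq).1
    simp at this
    omega

theorem removeLetter_eq_self {N : ℕ} {c : List (List ℕ)} (h : ∀ w ∈ c, N ∉ w)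
    (h' : ∀ w ∈ c, w ≠ []) : removeLetter N c = c := by
  have : c.map (List.filter (· ≠ N)) = c := by
    conv_rhs => rw [← List.map_id c]
    refine List.map_congr_left fun w hw => ?_
    rw [id, List.filter_eq_self]
    intro a ha
    have := h w hw
    simp only [ne_eq, decide_not, Bool.not_eq_eq_eq_not, Bool.not_true, decide_eq_false_iff_not]
    rintro rfl
    exact this ha
  rw [removeLetter, this, List.filter_eq_self]
  simpa using h'

theorem removeLetter_of_mem_cycleInsertions {N : ℕ} {c σ : List (List ℕ)}
    (h : ∀ w ∈ c, N ∉ w) (h' : ∀ w ∈ c, w ≠ []) (hσ : σ ∈ cycleInsertions N c) :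
    removeLetter N σ = c := by
  conv_rhs => rw [← removeLetter_eq_self h h']
  rw [mem_cycleInsertions] at hσ
  obtain rfl | ⟨A, u, v, B, hu, rfl, rfl⟩ := hσ <;> simp [removeLetter, List.filter_cons]

theorem isStirlingWord_iff {l : List ℕ} :
    IsStirlingWord l ↔ ∀ a x, [a, x, a].Sublist l → a < x := by
  constructor
  · intro h a x hs
    rw [List.sublist_iff_exists_fin_orderEmbedding_get_eq] at hs
    obtain ⟨f, hf⟩ := hs
    have h0 := hf ⟨0, by simp⟩
    have h1 := hf ⟨1, by simp⟩
    have h2 := hf ⟨2, by simp⟩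
    simp only [List.get_eq_getElem, List.getElem_cons_zero, List.getElem_cons_succ] at h0 h1 h2
    have := h (f ⟨0, by simp⟩) (f ⟨1, by simp⟩) (f ⟨2, by simp⟩)
      (f.lt_iff_lt.2 (by simp)) (f.lt_iff_lt.2 (by simp))
      (by simp only [List.get_eq_getElem]; rw [← h0, ← h2])
    simp only [List.get_eq_getElem] at this
    rwa [← h0, ← h1] at this
  · intro h i j k hij hjk hik
    apply h
    have hp : [i, j, k].Pairwise (· < ·) := by simp [hij, hjk, hij.trans hjk]
    have := List.map_getElem_sublist hp
    simp only [List.get_eq_getElem] at hik ⊢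
    simpa [← hik] using this

theorem isStirlingWord_insert_iff {N : ℕ} {u v : List ℕ} (h : ∀ a ∈ u ++ v, a < N) :
    IsStirlingWord (u ++ N :: N :: v) ↔ IsStirlingWord (u ++ v) := by
  simp only [isStirlingWord_iff]
  have hu : N ∉ u := fun hN => (h N (by simp [hN])).false
  have hv : N ∉ v := fun hN => (h N (by simp [hN])).false
  have hfu : u.filter (· ≠ N) = u := List.filter_eq_self.2 (by grind)
  have hfv : v.filter (· ≠ N) = v := List.filter_eq_self.2 (by grind)
  constructor
  · intro H a x hs
    refine H a x (hs.trans ?_)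
    exact List.Sublist.append_left
      ((List.sublist_cons_self _ _).trans (List.sublist_cons_self _ _)) u
  · intro H a x hs
    by_cases ha : a = N
    · subst ha
      exfalso
      rw [List.sublist_append_iff] at hs
      obtain ⟨l₁, l₂, he, hl₁, hl₂⟩ := hs
      obtain _ | ⟨b, l₁⟩ := l₁
      · simp only [List.nil_append] at he
        subst he
        have key : ∀ t, ¬ (t ++ [a]).Sublist v := fun t hs => hv (hs.subset (by simp))
        rw [List.cons_sublist_cons, List.sublist_cons_iff] at hl₂
        obtain hl₂ | ⟨r, hr, hl₂⟩ := hl₂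
        · exact key [x] hl₂
        · simp only [List.cons.injEq] at hr
          exact key [] (by simpa [← hr.2] using hl₂)
      · simp only [List.cons_append, List.cons.injEq] at he
        exact hu (hl₁.subset (by simp [he.1]))
    · by_cases hx : x = N
      · subst hx
        have : a ∈ u ++ x :: x :: v := hs.subset (by simp)
        exact h a (by simpa [ha] using this)
      · apply H
        have := hs.filter (· ≠ N)
        rw [List.filter_append, List.filter_cons_of_neg (a := N) (by simp),
          List.filter_cons_of_neg (a := N) (by simp), hfu, hfv] at this
        simpa [ha, hx] using this

theorem exists_eq_append_of_isStirlingWord {N : ℕ} {w : List ℕ} (h : ∀ a ∈ w, a ≤ N)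
    (hc : w.count N = 2) (hw : IsStirlingWord w) :
    ∃ u v, w = u ++ N :: N :: v ∧ N ∉ u ∧ N ∉ v := by
  have hN : N ∈ w := List.count_pos_iff.1 (by omega)
  obtain ⟨u, t, rfl, hu⟩ := List.eq_append_cons_of_mem hN
  have hu0 : u.count N = 0 := List.count_eq_zero.2 hu
  have ht : t.count N = 1 := by simpa [hu0] using hc
  obtain ⟨m, v, rfl, hm⟩ :=
    List.eq_append_cons_of_mem (List.count_pos_iff.1 (by omega : 0 < t.count N))
  have hm0 : m.count N = 0 := List.count_eq_zero.2 hm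
  have hv : v.count N = 0 := by simpa [hm0] using ht
  obtain _ | ⟨x, m⟩ := m
  · exact ⟨u, v, rfl, hu, List.count_eq_zero.1 hv⟩
  · exfalso
    have := isStirlingWord_iff.1 hw N x
      ((List.cons_sublist_cons.2 (List.cons_sublist_cons.2
        ((List.cons_sublist_cons.2 (List.nil_sublist v)).trans
          (List.sublist_append_right _ _)))).trans (List.sublist_append_right _ _))
    exact absurd (h x (by simp)) (by omega)

theorem baseList_succ (n : ℕ) : baseList (n + 1) = baseList n ++ [n + 1, n + 1] := by
  simp [baseList, List.range_succ]

theorem length_baseList (n : ℕ) : (baseList n).length = 2 * n := by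
  induction n with
  | zero => simp [baseList]
  | succ n ih => simp [baseList_succ, ih]; ring

theorem le_of_mem_baseList {n a : ℕ} (h : a ∈ baseList n) : a ≤ n := by
  simp only [baseList, List.mem_flatMap, List.mem_range] at h
  grind

theorem mem_stirling2 {n : ℕ} {c : List (List ℕ)} : c ∈ stirling2 n ↔ IsStirling2 n c := by
  rw [stirling2, Finset.mem_filter, and_iff_right_iff_imp]
  intro h
  have hsum : (c.map List.length).sum = 2 * n := by
    rw [← List.length_flatten, h.1.length_eq, length_baseList]
  have hpos : ∀ {i : ℕ}, i ∈ c.map List.length → 0 < i := by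
    simp only [List.mem_map]
    rintro _ ⟨w, hw, rfl⟩
    exact List.length_pos_iff.2 (h.2.1 w hw).1
  rw [Finset.mem_image]
  refine ⟨(c.flatten, ⟨c.map List.length, hpos, hsum⟩), ?_, ?_⟩
  · simpa using h.1
  · exact List.splitWrtComposition_flatten c
      ⟨c.map List.length, hpos, List.length_flatten.symm⟩ rfl

theorem IsStirling2.le {n : ℕ} {c : List (List ℕ)} (h : IsStirling2 n c) {w : List ℕ}
    (hw : w ∈ c) {a : ℕ} (ha : a ∈ w) : a ≤ n :=
  le_of_mem_baseList (h.1.subset (List.mem_flatten.2 ⟨w, hw, ha⟩))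

theorem chain_headI_iff {c : List (List ℕ)} :
    c.Chain' (fun w₁ w₂ => w₁.headI < w₂.headI) ↔ (c.map List.headI).Pairwise (· < ·) := by
  rw [← List.isChain_iff_pairwise, List.isChain_map]
  rfl

theorem headI_append {u v : List ℕ} (hu : u ≠ []) : (u ++ v).headI = u.headI := by
  cases u <;> simp_all

/-- The conditions on a single cycle of a Stirling permutation of the second kind. -/
def IsStirlingCycle (w : List ℕ) : Prop :=
  w ≠ [] ∧ (∀ v ∈ w, w.count v = 2) ∧ (∀ v ∈ w, w.headI ≤ v) ∧ IsStirlingWord w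

theorem isStirlingCycle_insert_iff {N : ℕ} {u v : List ℕ} (hu : u ≠ [])
    (h : ∀ a ∈ u ++ v, a < N) :
    IsStirlingCycle (u ++ N :: N :: v) ↔ IsStirlingCycle (u ++ v) := by
  have hN : N ∉ u ++ v := fun hN => (h N hN).false
  have hcN : (u ++ N :: N :: v).count N = 2 := by
    have := List.count_eq_zero.2 hN
    simp only [List.count_append, List.count_cons_self] at this ⊢
    omega
  have hc : ∀ a ∈ u ++ v, (u ++ N :: N :: v).count a = (u ++ v).count a := by
    intro a ha
    have := (h a ha).ne'
    simp [this]
  have hhead : u.headI < N := by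
    cases u
    · simp at hu
    · exact h _ (by simp)
  have hmem : ∀ a, a ∈ u ++ N :: N :: v ↔ a = N ∨ a ∈ u ++ v := by
    intro a; simp; tauto
  rw [IsStirlingCycle, IsStirlingCycle, isStirlingWord_insert_iff h, headI_append hu,
    headI_append hu]
  simp only [hmem, forall_eq_or_imp, hcN, hhead.le, true_and]
  rw [forall₂_congr fun a ha => by rw [hc a ha]]
  simp [hu]

theorem isStirling2_succ_append_iff {n : ℕ} {c : List (List ℕ)} (h : ∀ w ∈ c, ∀ a ∈ w, a ≤ n) :
    IsStirling2 (n + 1) (c ++ [[n + 1, n + 1]]) ↔ IsStirling2 n c := by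
  have hcyc : IsStirlingCycle [n + 1, n + 1] := by
    refine ⟨by simp, by simp, by simp, isStirlingWord_iff.2 fun a x hs => ?_⟩
    simpa using hs.length_le
  have e₁ : (c ++ [[n + 1, n + 1]]).flatten.Perm (baseList (n + 1)) ↔
      c.flatten.Perm (baseList n) := by
    rw [baseList_succ, List.flatten_append]
    simp [List.perm_append_right_iff]
  rw [IsStirling2, IsStirling2, e₁, chain_headI_iff, chain_headI_iff]
  refine and_congr_right fun _ => ?_
  change (∀ w ∈ _, IsStirlingCycle w) ∧ _ ↔ (∀ w ∈ _, IsStirlingCycle w) ∧ _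
  simp only [List.forall_mem_append, List.forall_mem_singleton, hcyc, and_true, List.map_append,
    List.map_cons, List.map_nil, List.headI_cons, List.pairwise_append]
  refine and_congr_right fun hw => ?_
  simp only [List.pairwise_cons, List.not_mem_nil, false_imp_iff, implies_true,
    List.Pairwise.nil, true_and, and_self, and_iff_left_iff_imp,
    List.mem_map, forall_exists_index, and_imp, forall_apply_eq_imp_iff₂]
  intro _ w hwc
  have hne := (hw w hwc).1
  refine Nat.lt_succ_of_le (h w hwc _ ?_)
  cases w <;> simp_all

theorem isStirling2_succ_insert_iff {n : ℕ} {A B : List (List ℕ)} {u v : List ℕ} (hu : u ≠ [])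
    (h : ∀ a ∈ u ++ v, a ≤ n) :
    IsStirling2 (n + 1) (A ++ (u ++ (n + 1) :: (n + 1) :: v) :: B) ↔
      IsStirling2 n (A ++ (u ++ v) :: B) := by
  have e₁ : (A ++ (u ++ (n + 1) :: (n + 1) :: v) :: B).flatten.Perm (baseList (n + 1)) ↔
      (A ++ (u ++ v) :: B).flatten.Perm (baseList n) := by
    rw [baseList_succ]
    simp only [List.perm_iff_count, List.flatten_append, List.flatten_cons, List.count_append,
      List.count_cons, List.count_nil]
    refine forall_congr' fun a => ?_
    omega
  rw [IsStirling2, IsStirling2, e₁, chain_headI_iff, chain_headI_iff]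
  refine and_congr_right fun _ => ?_
  change (∀ w ∈ _, IsStirlingCycle w) ∧ _ ↔ (∀ w ∈ _, IsStirlingCycle w) ∧ _
  simp only [List.forall_mem_append, List.forall_mem_cons, List.map_append, List.map_cons,
    headI_append hu]
  rw [isStirlingCycle_insert_iff hu fun a ha => Nat.lt_succ_of_le (h a ha)]

theorem exists_mem_cycleInsertions {n : ℕ} {σ : List (List ℕ)} (h : IsStirling2 (n + 1) σ) :
    ∃ c, IsStirling2 n c ∧ σ ∈ cycleInsertions (n + 1) c := by
  have hmem : n + 1 ∈ σ.flatten := h.1.mem_iff.2 (by simp [baseList_succ])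
  have hcount : σ.flatten.count (n + 1) = 2 := by
    have h0 : (baseList n).count (n + 1) = 0 :=
      List.count_eq_zero.2 fun hn => absurd (le_of_mem_baseList hn) (by omega)
    rw [h.1.count_eq, baseList_succ]
    simp [h0]
  obtain ⟨w, hw, hNw⟩ := List.mem_flatten.1 hmem
  obtain ⟨-, hc, hhead, hst⟩ := h.2.1 w hw
  obtain ⟨u, v, rfl, hNu, hNv⟩ :=
    exists_eq_append_of_isStirlingWord (fun a ha => h.le hw ha) (hc _ hNw) hst
  have hle : ∀ a ∈ u ++ v, a ≤ n := by
    intro a ha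
    have h1 : a ≤ n + 1 := h.le hw (by simp at ha ⊢; tauto)
    have h2 : a ≠ n + 1 := by rintro rfl; simp at ha; tauto
    omega
  obtain ⟨A, B, rfl⟩ := List.append_of_mem hw
  by_cases hu : u = []
  · subst hu
    have hv : v = [] := by
      refine List.eq_nil_iff_forall_not_mem.2 fun a ha => ?_
      have h1 := hhead a (by simp [ha])
      have h2 := hle a (by simp [ha])
      simp at h1
      omega
    subst hv
    have hpw := chain_headI_iff.1 h.2.2
    have hB : B = [] := by
      refine List.eq_nil_iff_forall_not_mem.2 fun w hwB => ?_
      have hne := (h.2.1 w (by simp [hwB])).1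
      have h1 : w.headI ≤ n + 1 := h.le (w := w) (by simp [hwB]) (by cases w <;> simp_all)
      simp only [List.map_append, List.map_cons, List.pairwise_append, List.pairwise_cons] at hpw
      have := hpw.2.1.1 _ (List.mem_map_of_mem hwB)
      simp at this
      omega
    subst hB
    have hA : ∀ w ∈ A, ∀ a ∈ w, a ≤ n := by
      intro w hwA a ha
      have h1 : a ≤ n + 1 := h.le (w := w) (by simp [hwA]) ha
      have h2 : a ≠ n + 1 := by
        rintro rfl
        have h3 : A.flatten.count (n + 1) = 0 := by simpa using hcount
        exact List.count_eq_zero.1 h3 (List.mem_flatten.2 ⟨w, hwA, ha⟩)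
      omega
    exact ⟨A, (isStirling2_succ_append_iff hA).1 h, mem_cycleInsertions.2 (Or.inl rfl)⟩
  · exact ⟨_, (isStirling2_succ_insert_iff hu hle).1 h,
      mem_cycleInsertions.2 (Or.inr ⟨A, u, v, B, hu, rfl, rfl⟩)⟩

theorem IsStirling2.of_mem_cycleInsertions {n : ℕ} {c σ : List (List ℕ)} (h : IsStirling2 n c)
    (hσ : σ ∈ cycleInsertions (n + 1) c) : IsStirling2 (n + 1) σ := by
  obtain rfl | ⟨A, u, v, B, hu, rfl, rfl⟩ := mem_cycleInsertions.1 hσ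
  · exact (isStirling2_succ_append_iff fun w hw a ha => h.le hw ha).2 h
  · exact (isStirling2_succ_insert_iff hu fun a ha => h.le (by simp) ha).2 h

theorem sum_stirling2_succ {M : Type*} [AddCommMonoid M] (n : ℕ) (f : List (List ℕ) → M) :
    ∑ σ ∈ stirling2 (n + 1), f σ =
      ∑ c ∈ stirling2 n, ((cycleInsertions (n + 1) c).map f).sum := by
  have hN : ∀ c ∈ stirling2 n, ∀ w ∈ c, n + 1 ∉ w := fun c hc w hw hn =>
    absurd ((mem_stirling2.1 hc).le hw hn) (by omega)
  have hne : ∀ c ∈ stirling2 n, ∀ w ∈ c, w ≠ [] := fun c hc w hw =>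
    ((mem_stirling2.1 hc).2.1 w hw).1
  have hunion : stirling2 (n + 1) =
      (stirling2 n).biUnion fun c => (cycleInsertions (n + 1) c).toFinset := by
    ext σ
    simp only [Finset.mem_biUnion, List.mem_toFinset, mem_stirling2]
    exact ⟨exists_mem_cycleInsertions, fun ⟨c, hc, hσ⟩ => hc.of_mem_cycleInsertions hσ⟩
  rw [hunion, Finset.sum_biUnion]
  · exact Finset.sum_congr rfl fun c hc =>
      List.sum_toFinset f (nodup_cycleInsertions (hN c hc))
  · intro c hc d hd hcd
    refine Finset.disjoint_left.2 fun σ hσc hσd => hcd ?_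
    rw [← removeLetter_of_mem_cycleInsertions (hN c hc) (hne c hc) (List.mem_toFinset.1 hσc),
      removeLetter_of_mem_cycleInsertions (hN d hd) (hne d hd) (List.mem_toFinset.1 hσd)]

theorem card_filter_range_succ (m : ℕ) (p : ℕ → Prop) [DecidablePred p] :
    ((Finset.range (m + 1)).filter p).card =
      (if p 0 then 1 else 0) + ((Finset.range m).filter fun i => p (i + 1)).card := by
  simp only [Finset.card_filter]
  rw [Finset.sum_range_succ', add_comm]

theorem card_ascentPlateaus (w : List ℕ) :
    ((Finset.range w.length).filter (fun i => 0 < i ∧ i + 1 < w.length ∧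
      w.getD (i - 1) 0 < w.getD i 0 ∧ w.getD i 0 = w.getD (i + 1) 0)).card = wordCap w := by
  induction w with
  | nil => simp [wordCap]
  | cons a w ih =>
    rw [List.length_cons, card_filter_range_succ]
    obtain _ | ⟨b, w⟩ := w
    · simp [wordCap]
    · rw [List.length_cons, card_filter_range_succ] at ih ⊢
      obtain _ | ⟨c, w⟩ := w
      · simp [wordCap]
      · rw [wordCap, ← ih]
        simp

theorem capSt_cons (w : List ℕ) (c : List (List ℕ)) : capSt (w :: c) = wordCap w + capSt c := by
  simp only [capSt, List.map_cons, List.sum_cons, card_ascentPlateaus]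

theorem fixSt_cons (w : List ℕ) (c : List (List ℕ)) :
    fixSt (w :: c) = (if ∃ k, w = [k, k] then 1 else 0) + fixSt c := by
  rw [fixSt, List.length_cons, card_filter_range_succ, fixSt]
  simp

section Weight

open MvPolynomial

theorem wordCap_cons_insert {N a : ℕ} {l : List ℕ} (h : ∀ b ∈ a :: l, b < N) :
    wordCap (a :: N :: N :: l) = 1 + wordCap l := by
  have haN : a < N := h a (by simp)
  obtain _ | ⟨b, _ | ⟨c, l⟩⟩ := l
  · simp [wordCap, haN]
  · have hbN : b < N := h b (by simp)
    simp [wordCap, haN, hbN.ne']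
  · have hbN : b < N := h b (by simp)
    simp [wordCap, haN, hbN.ne', hbN.not_gt]

theorem wordCap_cons_self (a : ℕ) (l : List ℕ) : wordCap (a :: a :: l) = wordCap (a :: l) := by
  cases l <;> simp [wordCap]

theorem sum_wordInsertions {R : Type*} [CommRing R] (x : R) {N : ℕ} {w : List ℕ}
    (h : ∀ a ∈ w, a < N) :
    ((wordInsertions N w).map fun w' => x ^ wordCap w').sum =
      2 * wordCap w * x ^ wordCap w + (w.length - 2 * wordCap w) * x ^ (wordCap w + 1) := by
  induction w with
  | nil => simp [wordInsertions, wordCap]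
  | cons a w ih =>
    obtain _ | ⟨b, _ | ⟨c, l⟩⟩ := w
    · simp [wordInsertions, wordCap, h a (by simp)]
    · have haN : a < N := h a (by simp)
      have hbN : b < N := h b (by simp)
      simp [wordInsertions, wordCap, haN, hbN, hbN.ne, hbN.ne']
      ring
    · have hbN : b < N := h b (by simp)
      have ih := ih fun d hd => h d (by simp [hd])
      have h₁ := wordCap_cons_insert h
      have h₂ := wordCap_cons_insert (l := c :: l) fun d hd => h d (List.mem_cons_of_mem a hd)
      have h₃ : wordCap (a :: b :: N :: N :: c :: l) = 1 + wordCap (c :: l) := by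
        rw [wordCap, h₂]
        simp [hbN.ne]
      have h₄ : ∀ w' ∈ wordInsertions N (c :: l), x ^ wordCap (a :: b :: w') =
          x ^ (if a < b ∧ b = c then 1 else 0) * x ^ wordCap (b :: w') := by
        intro w' hw'
        obtain ⟨_ | ⟨d, u⟩, v, hu, huv, rfl⟩ := mem_wordInsertions.1 hw'
        · simp at hu
        · simp only [List.cons_append, List.cons.injEq] at huv
          rw [← pow_add, List.cons_append, wordCap, huv.1]
      rw [wordInsertions] at ih
      rw [wordInsertions, wordInsertions]
      simp only [List.map_cons, List.map_map, List.sum_cons, Function.comp_def, h₁, h₂, h₃] at ih ⊢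
      rw [List.map_congr_left h₄, List.sum_map_mul_left, eq_sub_of_add_eq' ih]
      rw [show wordCap (a :: b :: c :: l) = (if a < b ∧ b = c then 1 else 0) +
        wordCap (b :: c :: l) from rfl]
      by_cases hab : a < b ∧ b = c
      · obtain ⟨hab, rfl⟩ := hab
        simp only [hab, and_self, if_true, wordCap_cons_self, List.length_cons]
        push_cast
        ring
      · simp only [hab, if_false, List.length_cons]
        push_cast
        ring

/-- The weight `x^cap y^fix q^cyc` of a list of cycles. -/
def weight (c : List (List ℕ)) : MvPolynomial (Fin 3) ℚ :=
  X 0 ^ capSt c * X 1 ^ fixSt c * X 2 ^ cyc c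

theorem weight_cons (w : List ℕ) (c : List (List ℕ)) :
    weight (w :: c) =
      X 0 ^ wordCap w * X 1 ^ (if ∃ k, w = [k, k] then 1 else 0) * X 2 * weight c := by
  rw [weight, weight, capSt_cons, fixSt_cons, cyc, cyc, List.length_cons]
  ring

theorem sum_weight_wordInsertions {N : ℕ} {w : List ℕ} (h : ∀ a ∈ w, a < N)
    (c : List (List ℕ)) :
    ((wordInsertions N w).map fun w' => weight (w' :: c)).sum =
      (2 * (wordCap w : MvPolynomial (Fin 3) ℚ) * X 0 ^ wordCap w +
        ((w.length : MvPolynomial (Fin 3) ℚ) - 2 * (wordCap w : MvPolynomial (Fin 3) ℚ)) *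
          X 0 ^ (wordCap w + 1)) * (X 2 * weight c) := by
  rw [← sum_wordInsertions (X 0) h, ← List.sum_map_mul_right]
  congr 1
  refine List.map_congr_left fun w' hw' => ?_
  have hfix : ¬ ∃ k, w' = [k, k] := by
    obtain ⟨u, v, hu, -, rfl⟩ := mem_wordInsertions.1 hw'
    rintro ⟨k, hk⟩
    have h₁ := congrArg List.length hk
    have h₂ := List.length_pos_iff.2 hu
    simp at h₁
    omega
  rw [weight_cons, if_neg hfix]
  ring

theorem sum_weight_cycleInsertions {N : ℕ} {c : List (List ℕ)} (h : ∀ w ∈ c, ∀ a ∈ w, a < N) :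
    ((cycleInsertions N c).map weight).sum =
      ((c.flatten.length : MvPolynomial (Fin 3) ℚ) * X 0 + X 2 * X 1) * weight c +
        2 * X 0 * (1 - X 0) * pderiv 0 (weight c) +
        2 * X 0 * (1 - X 1) * pderiv 1 (weight c) := by
  induction c with
  | nil =>
    have h₁ : weight [] = 1 := by simp [weight, capSt, fixSt, cyc]
    simp [cycleInsertions, weight_cons, h₁, wordCap]
    ring
  | cons w c ih =>
    have ih := ih fun w hw => h w (by simp [hw])
    simp only [cycleInsertions, List.map_append, List.map_map, Function.comp_def,
      List.sum_append, sum_weight_wordInsertions (h w (by simp))]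
    simp only [weight_cons w, List.sum_map_mul_left, ih]
    have d₂₀ : pderiv (R := ℚ) (0 : Fin 3) (X 2) = 0 := pderiv_X_of_ne (by decide)
    have d₁₀ : pderiv (R := ℚ) (0 : Fin 3) (X 1) = 0 := pderiv_X_of_ne (by decide)
    have d₂₁ : pderiv (R := ℚ) (1 : Fin 3) (X 2) = 0 := pderiv_X_of_ne (by decide)
    have d₀₁ : pderiv (R := ℚ) (1 : Fin 3) (X 0) = 0 := pderiv_X_of_ne (by decide)
    by_cases hw : ∃ k, w = [k, k]
    · obtain ⟨k, rfl⟩ := hw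
      simp [wordCap, d₂₀, d₁₀, d₂₁]
      ring
    · obtain hk | ⟨k, hk⟩ : wordCap w = 0 ∨ ∃ k, wordCap w = k + 1 := by
        cases wordCap w <;> simp
      all_goals
        simp [hw, hk, d₂₀, d₂₁, d₀₁]
        ring

end Weight

open MvPolynomial in
/-- For every `n ≥ 1`:
`P_{n+1}(x,y,q) = (2nx + qy) P_n + 2x(1-x) ∂P_n/∂x + 2x(1-y) ∂P_n/∂y`. -/
theorem stmt11 (n : ℕ) (hn : 1 ≤ n) :
    Pmv (n + 1) =
      (((2 * n : ℕ) : MvPolynomial (Fin 3) ℚ) * X 0 + X 2 * X 1) * Pmv n +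
        2 * X 0 * (1 - X 0) * pderiv 0 (Pmv n) +
        2 * X 0 * (1 - X 1) * pderiv 1 (Pmv n) := by
  have hflat : ∀ c ∈ stirling2 n, c.flatten.length = 2 * n := fun c hc => by
    rw [(mem_stirling2.1 hc).1.length_eq, length_baseList]
  change ∑ σ ∈ stirling2 (n + 1), weight σ = _ * (∑ c ∈ stirling2 n, weight c) +
    _ * pderiv 0 (∑ c ∈ stirling2 n, weight c) + _ * pderiv 1 (∑ c ∈ stirling2 n, weight c)
  rw [sum_stirling2_succ, map_sum, map_sum, Finset.mul_sum, Finset.mul_sum, Finset.mul_sum,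
    ← Finset.sum_add_distrib, ← Finset.sum_add_distrib]
  refine Finset.sum_congr rfl fun c hc => ?_
  rw [sum_weight_cycleInsertions fun w hw a ha =>
    Nat.lt_succ_of_le ((mem_stirling2.1 hc).le hw ha), hflat c hc]
end
end

section
/- Let D be the derivation on the polynomial ring ℚ[c,d] determined by D(c) = c·d² and D(d) = c²·d. Then for every integer n ≥ 1, 2·D^{n−1}(c²d²) = 2^n · Σ_{k=0}^{n−1} ⟨n,k⟩ · c^{2k+2} · d^{2n−2k}, where ⟨n,k⟩ are the Eulerian numbers. -/
open scoped Classical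
noncomputable section

open MvPolynomial

/-- The polynomial ring `ℚ[c,d]`, with `c = X 0` and `d = X 1`. -/
abbrev CD := MvPolynomial (Fin 2) ℚ

/-- The derivation `D` on `ℚ[c,d]` determined by `D(c) = c·d²` and `D(d) = c²·d`. -/
def Dder : Derivation ℚ CD CD :=
  mkDerivation ℚ (fun i : Fin 2 => if i = 0 then X 0 * X 1 ^ 2 else X 0 ^ 2 * X 1)

/-- Number of descents of a permutation of `Fin n`. -/
def desA (n : ℕ) (π : Equiv.Perm (Fin n)) : ℕ :=
  (Finset.univ.filter (fun i : Fin n => ∃ h : i.1 + 1 < n, π ⟨i.1 + 1, h⟩ < π i)).card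

/-- The Eulerian number `⟨n,k⟩`: the number of permutations of `[n]` with exactly `k`
descents (equivalently, defined by `⟨n,k⟩ = (k+1)⟨n-1,k⟩ + (n-k)⟨n-1,k-1⟩`). -/
def eulerianNum (n k : ℕ) : ℕ :=
  (Finset.univ.filter (fun π : Equiv.Perm (Fin n) => desA n π = k)).card

/-- The permutation of `Fin (n + 1)` obtained by inserting the largest value at position `p`. -/
def insertMax {n : ℕ} (p : Fin (n + 1)) (σ : Equiv.Perm (Fin n)) : Equiv.Perm (Fin (n + 1)) :=
  (finSuccEquiv' p).trans ((Equiv.optionCongr σ).trans (finSuccEquiv' (Fin.last n)).symm)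

theorem insertMax_self {n : ℕ} (p : Fin (n + 1)) (σ : Equiv.Perm (Fin n)) :
    insertMax p σ p = Fin.last n := by
  simp [insertMax]

theorem insertMax_succAbove {n : ℕ} (p : Fin (n + 1)) (σ : Equiv.Perm (Fin n)) (k : Fin n) :
    insertMax p σ (p.succAbove k) = (σ k).castSucc := by
  simp [insertMax]

theorem insertMax_bijective (n : ℕ) :
    Function.Bijective
      (fun x : Fin (n + 1) × Equiv.Perm (Fin n) => insertMax x.1 x.2) := by
  rw [Fintype.bijective_iff_injective_and_card]
  constructor
  · rintro ⟨p, σ⟩ ⟨q, τ⟩ h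
    have hpq : p = q := by
      apply (insertMax q τ).injective
      rw [insertMax_self, ← insertMax_self p σ]
      exact (congrArg (fun e => e p) h).symm
    subst hpq
    have hστ : σ = τ := by
      ext k
      have hk := congrArg (fun e => e (p.succAbove k)) h
      simp only [insertMax_succAbove] at hk
      exact congrArg Fin.val (Fin.castSucc_injective n hk)
    rw [hστ]
  · simp [Fintype.card_perm, Nat.factorial_succ]

/-- The permutation `π` has a descent at position `i`. -/
def IsDescent {n : ℕ} (π : Equiv.Perm (Fin n)) (i : Fin n) : Prop :=
  ∃ h : i.1 + 1 < n, π ⟨i.1 + 1, h⟩ < π i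

theorem desA_eq_sum {n : ℕ} (π : Equiv.Perm (Fin n)) :
    desA n π = ∑ i, if IsDescent π i then 1 else 0 := by
  rw [← Finset.card_filter]
  unfold desA IsDescent
  congr

theorem desA_lt {n : ℕ} (hn : 1 ≤ n) (π : Equiv.Perm (Fin n)) : desA n π < n := by
  have h := Finset.card_lt_univ_of_notMem
    (s := Finset.univ.filter (fun i : Fin n => ∃ h : i.1 + 1 < n, π ⟨i.1 + 1, h⟩ < π i))
    (x := ⟨n - 1, by omega⟩) (by
      simp only [Finset.mem_filter, not_and]
      rintro - ⟨h, -⟩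
      omega)
  rw [Fintype.card_fin] at h
  unfold desA
  convert h

theorem isDescent_insertMax_self {n : ℕ} (p : Fin (n + 1)) (σ : Equiv.Perm (Fin n)) :
    IsDescent (insertMax p σ) p ↔ p.1 < n := by
  refine ⟨fun ⟨h, _⟩ => by omega, fun h => ⟨by omega, ?_⟩⟩
  rw [insertMax_self, Fin.lt_last_iff_ne_last, ← insertMax_self p σ]
  intro h'
  have := congrArg Fin.val ((insertMax p σ).injective h')
  simp at this

theorem not_isDescent_insertMax {n : ℕ} (i : Fin n) (σ : Equiv.Perm (Fin n)) :
    ¬ IsDescent (insertMax i.succ σ) (i.succ.succAbove i) := by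
  rintro ⟨h, hlt⟩
  have hi : (⟨(i.succ.succAbove i).1 + 1, h⟩ : Fin (n + 1)) = i.succ := by
    ext; simp
  rw [hi, insertMax_self] at hlt
  exact absurd hlt (Fin.le_last _).not_gt

theorem isDescent_insertMax_succAbove {n : ℕ} (p : Fin (n + 1)) (σ : Equiv.Perm (Fin n))
    (k : Fin n) (hk : k.1 + 1 ≠ p.1) :
    IsDescent (insertMax p σ) (p.succAbove k) ↔ IsDescent σ k := by
  have hval (j : Fin n) : (p.succAbove j).1 = if j.1 < p.1 then j.1 else j.1 + 1 := by
    simp only [Fin.succAbove, Fin.lt_def, Fin.val_castSucc]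
    split_ifs <;> rfl
  have hnext (h : k.1 + 1 < n) (h' : (p.succAbove k).1 + 1 < n + 1) :
      (⟨(p.succAbove k).1 + 1, h'⟩ : Fin (n + 1)) = p.succAbove ⟨k.1 + 1, h⟩ := by
    ext
    simp only [hval]
    split_ifs <;> omega
  constructor
  · rintro ⟨h', hlt⟩
    have h : k.1 + 1 < n := by
      have := hval k
      split_ifs at this <;> omega
    rw [hnext h h', insertMax_succAbove, insertMax_succAbove] at hlt
    exact ⟨h, hlt⟩
  · rintro ⟨h, hlt⟩
    have h' : (p.succAbove k).1 + 1 < n + 1 := by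
      have := hval k
      split_ifs at this <;> omega
    refine ⟨h', ?_⟩
    rw [hnext h h', insertMax_succAbove, insertMax_succAbove]
    exact hlt

theorem desA_insertMax_zero {n : ℕ} (hn : 1 ≤ n) (σ : Equiv.Perm (Fin n)) :
    desA (n + 1) (insertMax 0 σ) = desA n σ + 1 := by
  rw [desA_eq_sum, desA_eq_sum, Fin.sum_univ_succAbove _ 0,
    if_pos ((isDescent_insertMax_self 0 σ).2 (Nat.lt_of_succ_le hn)), add_comm]
  congr 1
  refine Finset.sum_congr rfl fun k _ => ?_
  simp only [isDescent_insertMax_succAbove 0 σ k (by simp)]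

theorem desA_insertMax_succ {n : ℕ} (i : Fin n) (σ : Equiv.Perm (Fin n)) :
    desA (n + 1) (insertMax i.succ σ) =
      if IsDescent σ i ∨ i.1 + 1 = n then desA n σ else desA n σ + 1 := by
  have hsum : ∑ k ∈ Finset.univ.erase i,
        (if IsDescent (insertMax i.succ σ) (i.succ.succAbove k) then 1 else 0) =
      ∑ k ∈ Finset.univ.erase i, if IsDescent σ k then 1 else 0 := by
    refine Finset.sum_congr rfl fun k hk => ?_
    have hki : k.1 + 1 ≠ i.succ.1 := by
      simpa [Fin.ext_iff] using hk
    simp only [isDescent_insertMax_succAbove i.succ σ k hki]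
  have hself := isDescent_insertMax_self i.succ σ
  rw [Fin.val_succ] at hself
  rw [desA_eq_sum, desA_eq_sum, Fin.sum_univ_succAbove _ i.succ,
    ← Finset.add_sum_erase _ _ (Finset.mem_univ i), hsum,
    ← Finset.add_sum_erase _ (fun k => if IsDescent σ k then 1 else 0) (Finset.mem_univ i),
    if_neg (not_isDescent_insertMax i σ)]
  simp only [hself]
  have hi := i.2
  by_cases hd : IsDescent σ i
  · have : i.1 + 1 < n := hd.1
    simp [hd, this]
  · by_cases hl : i.1 + 1 = n
    · simp [hd, hl]
    · have : i.1 + 1 < n := by omega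
      simp [hd, hl, this, add_comm]

theorem card_isDescent_or_last {n : ℕ} (hn : 1 ≤ n) (σ : Equiv.Perm (Fin n)) :
    (Finset.univ.filter fun i : Fin n => IsDescent σ i ∨ i.1 + 1 = n).card = desA n σ + 1 := by
  rw [Finset.filter_or, Finset.card_union_of_disjoint]
  · rw [desA_eq_sum, ← Finset.card_filter]
    congr 1
    rw [Finset.card_eq_one]
    refine ⟨⟨n - 1, by omega⟩, ?_⟩
    ext i
    simp only [Finset.mem_filter, Finset.mem_univ, true_and, Finset.mem_singleton, Fin.ext_iff]
    omega
  · rw [Finset.disjoint_filter]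
    rintro i - ⟨h, -⟩
    omega

/-- The Eulerian recurrence, in summed form. -/
theorem sum_perm_succ {n : ℕ} (hn : 1 ≤ n) {R : Type*} [CommRing R] (f : ℕ → R) :
    ∑ π : Equiv.Perm (Fin (n + 1)), f (desA (n + 1) π) =
      ∑ σ : Equiv.Perm (Fin n),
        (((desA n σ + 1 : ℕ) : R) * f (desA n σ) +
          ((n - desA n σ : ℕ) : R) * f (desA n σ + 1)) := by
  rw [← (insertMax_bijective n).sum_comp (fun π => f (desA (n + 1) π)),
    Fintype.sum_prod_type_right]
  refine Finset.sum_congr rfl fun σ _ => ?_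
  have hcard := Finset.card_filter_add_card_filter_not (s := (Finset.univ : Finset (Fin n)))
    (fun i => IsDescent σ i ∨ i.1 + 1 = n)
  rw [card_isDescent_or_last hn, Finset.card_univ, Fintype.card_fin] at hcard
  have hn' : n - desA n σ =
      (Finset.univ.filter fun i : Fin n => ¬ (IsDescent σ i ∨ i.1 + 1 = n)).card + 1 := by
    omega
  rw [Fin.sum_univ_succ]
  simp only [desA_insertMax_zero hn, desA_insertMax_succ, apply_ite f]
  rw [Finset.sum_ite, Finset.sum_const, Finset.sum_const, card_isDescent_or_last hn, hn']
  simp only [nsmul_eq_mul]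
  push_cast
  ring

theorem sum_eulerianNum_mul {n : ℕ} (hn : 1 ≤ n) {R : Type*} [CommRing R] (f : ℕ → R) :
    ∑ k ∈ Finset.range n, (eulerianNum n k : R) * f k =
      ∑ π : Equiv.Perm (Fin n), f (desA n π) := by
  rw [← Finset.sum_fiberwise_of_maps_to (t := Finset.range n) (g := desA n)
    (fun π _ => Finset.mem_range.2 (desA_lt hn π))]
  refine Finset.sum_congr rfl fun k _ => ?_
  rw [Finset.sum_congr rfl fun π hπ => by rw [(Finset.mem_filter.1 hπ).2], Finset.sum_const,
    nsmul_eq_mul]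
  rfl

theorem Dder_monomial (a b : ℕ) :
    Dder (X 0 ^ (2 * a + 2) * X 1 ^ (2 * b) : CD) =
      2 * (((a + 1 : ℕ) : CD) * (X 0 ^ (2 * a + 2) * X 1 ^ (2 * (b + 1))) +
        (b : CD) * (X 0 ^ (2 * (a + 1) + 2) * X 1 ^ (2 * b))) := by
  have h0 : Dder (X 0) = X 0 * X 1 ^ 2 := by simp [Dder, mkDerivation_X]
  have h1 : Dder (X 1) = X 0 ^ 2 * X 1 := by simp [Dder, mkDerivation_X]
  rw [Derivation.leibniz, Derivation.leibniz_pow, Derivation.leibniz_pow, h0, h1]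
  simp only [smul_eq_mul, nsmul_eq_mul]
  rcases b with _ | b
  · simp
    ring
  · rw [show 2 * (b + 1) - 1 = 2 * b + 1 by omega, show 2 * a + 2 - 1 = 2 * a + 1 by omega]
    push_cast
    ring

theorem two_mul_iterate_Dder {n : ℕ} (hn : 1 ≤ n) :
    2 * (fun p : CD => Dder p)^[n - 1] (X 0 ^ 2 * X 1 ^ 2) =
      (2 : CD) ^ n * ∑ π : Equiv.Perm (Fin n),
        X 0 ^ (2 * desA n π + 2) * X 1 ^ (2 * (n - desA n π)) := by
  induction n, hn using Nat.le_induction with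
  | base =>
    have h (π : Equiv.Perm (Fin 1)) : desA 1 π = 0 := by
      have := desA_lt le_rfl π
      omega
    simp [h]
  | succ n hn ih =>
    have hconst (m : ℕ) (p : CD) : Dder (2 ^ m * p) = 2 ^ m * Dder p := by
      have h2 : (2 : CD) ^ m = C (2 ^ m) := by rw [map_pow, map_ofNat]
      rw [h2, ← smul_eq_C_mul, ← smul_eq_C_mul, Derivation.map_smul]
    have hiter : 2 * (fun p : CD => Dder p)^[n] (X 0 ^ 2 * X 1 ^ 2) =
        Dder (2 * (fun p : CD => Dder p)^[n - 1] (X 0 ^ 2 * X 1 ^ 2)) := by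
      have h2 := hconst 1 ((fun p : CD => Dder p)^[n - 1] (X 0 ^ 2 * X 1 ^ 2))
      rw [pow_one] at h2
      obtain ⟨m, rfl⟩ : ∃ m, n = m + 1 := ⟨n - 1, by omega⟩
      rw [h2, Function.iterate_succ_apply', Nat.add_sub_cancel]
    rw [Nat.add_sub_cancel, hiter, ih, hconst, map_sum,
      sum_perm_succ hn (fun k => (X 0 ^ (2 * k + 2) * X 1 ^ (2 * (n + 1 - k)) : CD)),
      pow_succ, mul_assoc, Finset.mul_sum (a := (2 : CD))]
    congr 1
    refine Finset.sum_congr rfl fun π _ => ?_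
    have hlt := desA_lt hn π
    rw [Dder_monomial, show n + 1 - desA n π = n - desA n π + 1 by omega,
      show n + 1 - (desA n π + 1) = n - desA n π by omega]

/-- For every `n ≥ 1`:
`2·D^{n-1}(c²d²) = 2^n · ∑_{k=0}^{n-1} ⟨n,k⟩ c^{2k+2} d^{2n-2k}`. -/
theorem stmt12 (n : ℕ) (hn : 1 ≤ n) :
    2 * (fun p : CD => Dder p)^[n - 1] (X 0 ^ 2 * X 1 ^ 2) =
      (2 : CD) ^ n *
        ∑ k ∈ Finset.range n,
          (eulerianNum n k : CD) * X 0 ^ (2 * k + 2) * X 1 ^ (2 * n - 2 * k) := by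
  rw [two_mul_iterate_Dder hn,
    ← sum_eulerianNum_mul hn (fun k => (X 0 ^ (2 * k + 2) * X 1 ^ (2 * (n - k)) : CD))]
  simp only [mul_assoc, Nat.mul_sub]
end
end

section
/- For all integers n ≥ 0 and 0 ≤ k ≤ n, R_{n,k}(x,q) = C(n,k) · q^k · R_{n−k}(x,q), where R_{n,k}(x,q) = Σ_{σ ∈ Q_n^2, fix(σ)=k} x^{cap(σ)} q^{cyc(σ)}, R_m(x,q) = R_{m,0}(x,q), and C(n,k) is the binomial coefficient. -/
open scoped Classical
noncomputable section

open MvPolynomial in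
/-- `R_{n,k}(x,q) = ∑_{σ ∈ Q_n², fix(σ) = k} x^{cap(σ)} q^{cyc(σ)}`, in the variables
`x = X 0`, `q = X 1`. -/
def Rnk (n k : ℕ) : MvPolynomial (Fin 2) ℚ :=
  ∑ σ ∈ (stirling2 n).filter (fun σ => fixSt σ = k), X 0 ^ capSt σ * X 1 ^ cyc σ

/-- The Stirling derangement polynomial `R_n(x,q) = R_{n,0}(x,q)`:  the sum of
`x^{cap(σ)} q^{cyc(σ)}` over Stirling derangements (fixed-point-free `σ ∈ Q_n²`). -/
def Rq (n : ℕ) : MvPolynomial (Fin 2) ℚ := Rnk n 0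

/-- The condition on a single cycle in `IsStirling2`. -/
def IsCycleWord (w : List ℕ) : Prop :=
  w ≠ [] ∧ (∀ v ∈ w, w.count v = 2) ∧ (∀ v ∈ w, w.headI ≤ v) ∧ IsStirlingWord w

/-- The word of a fixed point. -/
def IsFixedWord (w : List ℕ) : Prop := ∃ k : ℕ, w = [k, k]

/-- The number of ascent plateaus of a single cycle. -/
def capWord (w : List ℕ) : ℕ :=
  ((Finset.range w.length).filter
    (fun i => 0 < i ∧ i + 1 < w.length ∧
      w.getD (i - 1) 0 < w.getD i 0 ∧ w.getD i 0 = w.getD (i + 1) 0)).card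

/-- The sets of cycles of the Stirling permutations of the second kind of the multiset in which
each element of `A` occurs twice. -/
def cycleSystems (A : Finset ℕ) : Finset (Finset (List ℕ)) :=
  ((2 • A.val).powerset.toFinset.biUnion (fun s => s.lists.toFinset)).powerset.filter
    (fun T => (∀ w ∈ T, IsCycleWord w) ∧ ∑ w ∈ T, (w : Multiset ℕ) = 2 • A.val)

theorem mem_cycleSystems {A : Finset ℕ} {T : Finset (List ℕ)} :
    T ∈ cycleSystems A ↔
      (∀ w ∈ T, IsCycleWord w) ∧ ∑ w ∈ T, (w : Multiset ℕ) = 2 • A.val := by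
  simp only [cycleSystems, Finset.mem_filter, Finset.mem_powerset, and_iff_right_iff_imp]
  rintro ⟨-, h⟩ w hw
  simp only [Finset.mem_biUnion, Multiset.mem_toFinset, Multiset.mem_powerset]
  refine ⟨w, ?_, by simp⟩
  rw [← h]
  exact Finset.single_le_sum (f := fun w : List ℕ => (w : Multiset ℕ))
    (fun _ _ => Multiset.zero_le _) hw

open MvPolynomial in
/-- The monomial contributed by a single cycle. -/
def cycleWeight (w : List ℕ) : MvPolynomial (Fin 2) ℚ := X 0 ^ capWord w * X 1

/-- The weighted count of the cycle systems on `A` without fixed points. -/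
def derangementSum (A : Finset ℕ) : MvPolynomial (Fin 2) ℚ :=
  ∑ T ∈ (cycleSystems A).filter (fun T => ∀ w ∈ T, ¬ IsFixedWord w), ∏ w ∈ T, cycleWeight w

theorem isCycleWord_fixed (a : ℕ) : IsCycleWord [a, a] := by
  refine ⟨by simp, by simp, by simp, ?_⟩
  intro i j k hij hjk
  have hk := k.isLt
  simp only [List.length_cons, List.length_nil] at hk
  rw [Fin.lt_def] at hij hjk
  omega

theorem capWord_fixed (a : ℕ) : capWord [a, a] = 0 := by
  simp only [capWord, Finset.card_eq_zero, Finset.filter_eq_empty_iff, List.length_cons,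
    List.length_nil]
  intro i hi
  omega

/-! ### Relabelling -/

theorem isStirlingWord_map {f : ℕ → ℕ} (hf : StrictMono f) (w : List ℕ) :
    IsStirlingWord (w.map f) ↔ IsStirlingWord w := by
  have key (l : List ℕ) : IsStirlingWord l ↔ ∀ (i j k : ℕ) (hij : i < j) (hjk : j < k)
      (hk : k < l.length), l[i] = l[k] → l[i] < l[j] :=
    ⟨fun h i j k hij hjk hk => h ⟨i, by omega⟩ ⟨j, by omega⟩ ⟨k, hk⟩ hij hjk,
      fun h i j k hij hjk => h i j k hij hjk k.isLt⟩
  rw [key, key]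
  simp [hf.injective.eq_iff, hf.lt_iff_lt]

theorem isCycleWord_map {f : ℕ → ℕ} (hf : StrictMono f) (w : List ℕ) :
    IsCycleWord (w.map f) ↔ IsCycleWord w := by
  unfold IsCycleWord
  rw [isStirlingWord_map hf]
  rcases w with _ | ⟨a, w⟩
  · simp
  · have h (v : ℕ) := List.count_map_of_injective (a :: w) f hf.injective v
    simp only [List.forall_mem_map, h]
    simp [hf.le_iff_le]

theorem isFixedWord_map {f : ℕ → ℕ} (hf : StrictMono f) (w : List ℕ) :
    IsFixedWord (w.map f) ↔ IsFixedWord w := by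
  constructor
  · rintro ⟨k, hk⟩
    rcases w with _ | ⟨a, _ | ⟨b, _ | ⟨c, w⟩⟩⟩ <;> simp at hk
    obtain ⟨rfl, h⟩ := hk
    exact ⟨a, by simp [hf.injective h]⟩
  · rintro ⟨k, rfl⟩
    exact ⟨f k, rfl⟩

theorem capWord_map {f : ℕ → ℕ} (hf : StrictMono f) (w : List ℕ) :
    capWord (w.map f) = capWord w := by
  unfold capWord
  rw [List.length_map]
  congr 1
  refine Finset.filter_congr fun i hi => and_congr_right fun h0 => and_congr_right fun h1 => ?_
  have h2 : i < w.length := by omega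
  have h3 : i - 1 < w.length := by omega
  simp [List.getD_eq_getElem?_getD, h1, h2, h3, hf.injective.eq_iff, hf.lt_iff_lt]

theorem sum_coe_image_map {f : ℕ → ℕ} (hf : StrictMono f) (T : Finset (List ℕ)) :
    ∑ w ∈ T.image (List.map f), (w : Multiset ℕ) = (∑ w ∈ T, (w : Multiset ℕ)).map f := by
  rw [Finset.sum_image (List.map_injective_iff.2 hf.injective).injOn]
  simp only [← Multiset.map_coe]
  exact (map_sum (Multiset.mapAddMonoidHom f) (fun w : List ℕ => (w : Multiset ℕ)) T).symm

theorem image_map_mem_cycleSystems {f : ℕ → ℕ} (hf : StrictMono f) (A : Finset ℕ)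
    (T : Finset (List ℕ)) :
    T.image (List.map f) ∈ cycleSystems (A.image f) ↔ T ∈ cycleSystems A := by
  rw [mem_cycleSystems, mem_cycleSystems, sum_coe_image_map hf,
    Finset.image_val_of_injOn hf.injective.injOn, ← Multiset.map_nsmul,
    (Multiset.map_injective hf.injective).eq_iff]
  simp [isCycleWord_map hf]

theorem mem_of_mem_cycleSystems {A : Finset ℕ} {T : Finset (List ℕ)} (hT : T ∈ cycleSystems A)
    {w : List ℕ} (hw : w ∈ T) {a : ℕ} (ha : a ∈ w) : a ∈ A := by
  have h : a ∈ 2 • A.val := by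
    rw [← (mem_cycleSystems.1 hT).2, Multiset.mem_sum]
    exact ⟨w, hw, by simpa using ha⟩
  exact Multiset.mem_of_mem_nsmul h

theorem derangementSum_image {f : ℕ → ℕ} (hf : StrictMono f) (A : Finset ℕ) :
    derangementSum (A.image f) = derangementSum A := by
  have hinj : Function.Injective (List.map f) := List.map_injective_iff.2 hf.injective
  symm
  refine Finset.sum_nbij (fun T => T.image (List.map f)) ?_ ?_ ?_ ?_
  · intro T hT
    simp only [Finset.mem_filter] at hT ⊢
    refine ⟨(image_map_mem_cycleSystems hf A T).2 hT.1, ?_⟩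
    simpa [isFixedWord_map hf] using hT.2
  · exact (Finset.image_injective hinj).injOn
  · intro T' hT'
    simp only [Finset.coe_filter, Set.mem_ofPred_eq] at hT'
    have hsub : (T' : Set (List ℕ)) ⊆ List.map f '' Set.univ := by
      intro w hw
      rw [Set.image_univ, Set.range_list_map]
      intro a ha
      obtain ⟨b, -, hb⟩ := Finset.mem_image.1 (mem_of_mem_cycleSystems hT'.1 hw ha)
      exact ⟨b, hb⟩
    obtain ⟨T, -, rfl⟩ := Finset.subset_set_image_iff.1 hsub
    refine ⟨T, ?_, rfl⟩
    simp only [Finset.coe_filter, Set.mem_ofPred_eq]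
    refine ⟨(image_map_mem_cycleSystems hf A T).1 hT'.1, ?_⟩
    simpa [isFixedWord_map hf] using hT'.2
  · intro T _
    rw [Finset.prod_image hinj.injOn]
    simp [cycleWeight, capWord_map hf]

theorem exists_strictMono_image_range (B : Finset ℕ) :
    ∃ f : ℕ → ℕ, StrictMono f ∧ (Finset.range B.card).image f = B := by
  induction B using Finset.induction_on_max with
  | empty => exact ⟨id, strictMono_id, rfl⟩
  | insert a B hlt ih =>
    obtain ⟨f, hf, hB⟩ := ih
    have ha : a ∉ B := fun h => (hlt a h).false
    have hfa (i : ℕ) (hi : i < B.card) : f i < a :=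
      hlt _ (hB ▸ Finset.mem_image_of_mem f (Finset.mem_range.2 hi))
    refine ⟨fun i => if i < B.card then f i else a + (i - B.card), ?_, ?_⟩
    · intro i j hij
      have := hf hij
      dsimp only
      split_ifs with h1 h2
      · exact this
      · have := hfa i h1
        omega
      · omega
      · omega
    · rw [Finset.card_insert_of_notMem ha, Finset.range_add_one, Finset.image_insert]
      congr 1
      · simp
      · conv_rhs => rw [← hB]
        exact Finset.image_congr fun i hi => if_pos (by simpa using hi)

theorem derangementSum_eq_of_card_eq {A B : Finset ℕ} (h : A.card = B.card) :
    derangementSum A = derangementSum B := by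
  obtain ⟨f, hf, hA⟩ := exists_strictMono_image_range A
  obtain ⟨g, hg, hB⟩ := exists_strictMono_image_range B
  rw [← hA, ← hB, derangementSum_image hf, derangementSum_image hg, h]

/-! ### Splitting off the fixed points -/

/-- The words of the fixed points in `S`. -/
def fixedWords (S : Finset ℕ) : Finset (List ℕ) := S.image (fun a => [a, a])

theorem mem_fixedWords {S : Finset ℕ} {w : List ℕ} : w ∈ fixedWords S ↔ ∃ a ∈ S, [a, a] = w := by
  simp [fixedWords]

theorem fixedWords_injective : Function.Injective (fun a : ℕ => [a, a]) := fun a b h => by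
  simpa using h

theorem sum_coe_fixedWords (S : Finset ℕ) :
    ∑ w ∈ fixedWords S, (w : Multiset ℕ) = 2 • S.val := by
  rw [fixedWords, Finset.sum_image fixedWords_injective.injOn]
  have h (a : ℕ) : (([a, a] : List ℕ) : Multiset ℕ) = 2 • {a} := rfl
  simp only [h, Finset.sum_nsmul, Finset.sum_multiset_singleton]

theorem filter_isFixedWord_eq {A : Finset ℕ} {T : Finset (List ℕ)} (hT : T ∈ cycleSystems A) :
    T.filter IsFixedWord = fixedWords (A.filter (fun a => [a, a] ∈ T)) := by
  ext w
  simp only [Finset.mem_filter, mem_fixedWords]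
  constructor
  · rintro ⟨hw, a, rfl⟩
    exact ⟨a, ⟨mem_of_mem_cycleSystems hT hw (by simp), hw⟩, rfl⟩
  · rintro ⟨a, ⟨-, hw⟩, rfl⟩
    exact ⟨hw, a, rfl⟩

theorem disjoint_fixedWords (S : Finset ℕ) {T : Finset (List ℕ)}
    (hT : ∀ w ∈ T, ¬ IsFixedWord w) : Disjoint (fixedWords S) T := by
  rw [Finset.disjoint_left]
  intro w hw hwT
  obtain ⟨a, -, rfl⟩ := mem_fixedWords.1 hw
  exact hT _ hwT ⟨a, rfl⟩

theorem fixedWords_union_mem_cycleSystems {A S : Finset ℕ} (hS : S ⊆ A) {T : Finset (List ℕ)}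
    (hT : ∀ w ∈ T, ¬ IsFixedWord w) :
    fixedWords S ∪ T ∈ cycleSystems A ↔ T ∈ cycleSystems (A \ S) := by
  have hA : A.val = S.val + (A \ S).val := by
    rw [Finset.sdiff_val, add_tsub_cancel_of_le (Finset.val_le_iff.2 hS)]
  rw [mem_cycleSystems, mem_cycleSystems, Finset.sum_union (disjoint_fixedWords S hT),
    sum_coe_fixedWords, hA, nsmul_add, add_right_inj]
  refine and_congr_left fun _ => ⟨fun h w hw => h w (Finset.mem_union_right _ hw), ?_⟩
  intro h w hw
  rcases Finset.mem_union.1 hw with hw | hw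
  · obtain ⟨a, -, rfl⟩ := mem_fixedWords.1 hw
    exact isCycleWord_fixed a
  · exact h w hw

open MvPolynomial in
theorem sum_cycleSystems_fixed_eq {A S : Finset ℕ} (hS : S ⊆ A) :
    ∑ T ∈ (cycleSystems A).filter (fun T => A.filter (fun a => [a, a] ∈ T) = S),
      ∏ w ∈ T, cycleWeight w = X 1 ^ S.card * derangementSum (A \ S) := by
  rw [derangementSum, Finset.mul_sum]
  symm
  refine Finset.sum_bij (fun T _ => fixedWords S ∪ T) ?_ ?_ ?_ ?_
  · intro T hT
    rw [Finset.mem_filter] at hT ⊢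
    refine ⟨(fixedWords_union_mem_cycleSystems hS hT.2).2 hT.1, ?_⟩
    ext a
    simp only [Finset.mem_filter, Finset.mem_union, mem_fixedWords]
    constructor
    · rintro ⟨-, ⟨b, hb, h⟩ | h⟩
      · rwa [← fixedWords_injective h]
      · exact absurd ⟨a, rfl⟩ (hT.2 _ h)
    · exact fun ha => ⟨hS ha, Or.inl ⟨a, ha, rfl⟩⟩
  · intro T hT T' hT' h
    rw [Finset.mem_filter] at hT hT'
    rw [← Finset.union_sdiff_cancel_left (disjoint_fixedWords S hT.2), h,
      Finset.union_sdiff_cancel_left (disjoint_fixedWords S hT'.2)]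
  · intro T hT
    rw [Finset.mem_filter] at hT
    have hfix := filter_isFixedWord_eq hT.1
    rw [hT.2] at hfix
    have hunion : fixedWords S ∪ T.filter (fun w => ¬ IsFixedWord w) = T := by
      rw [← hfix, Finset.filter_union_filter_not_eq]
    have hder : ∀ w ∈ T.filter (fun w => ¬ IsFixedWord w), ¬ IsFixedWord w :=
      fun w hw => (Finset.mem_filter.1 hw).2
    refine ⟨T.filter (fun w => ¬ IsFixedWord w), ?_, hunion⟩
    rw [Finset.mem_filter, ← fixedWords_union_mem_cycleSystems hS hder, hunion]
    exact ⟨hT.1, hder⟩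
  · intro T hT
    rw [Finset.mem_filter] at hT
    rw [Finset.prod_union (disjoint_fixedWords S hT.2), fixedWords,
      Finset.prod_image fixedWords_injective.injOn]
    simp [cycleWeight, capWord_fixed]

open MvPolynomial in
theorem sum_cycleSystems_card_fixed_eq (A : Finset ℕ) (k : ℕ) (B : Finset ℕ)
    (hB : B.card = A.card - k) :
    ∑ T ∈ (cycleSystems A).filter (fun T => (T.filter IsFixedWord).card = k),
      ∏ w ∈ T, cycleWeight w =
      (A.card.choose k : MvPolynomial (Fin 2) ℚ) * X 1 ^ k * derangementSum B := by
  have hcard {T : Finset (List ℕ)} (hT : T ∈ cycleSystems A) :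
      (T.filter IsFixedWord).card = (A.filter (fun a => [a, a] ∈ T)).card := by
    rw [filter_isFixedWord_eq hT, fixedWords, Finset.card_image_of_injective _ fixedWords_injective]
  rw [← Finset.sum_fiberwise_of_maps_to (t := A.powersetCard k)
    (g := fun T => A.filter (fun a => [a, a] ∈ T))]
  · rw [← Finset.card_powersetCard, mul_assoc, ← nsmul_eq_mul, ← Finset.sum_const]
    refine Finset.sum_congr rfl fun S hS => ?_
    obtain ⟨hSA, rfl⟩ := Finset.mem_powersetCard.1 hS
    rw [derangementSum_eq_of_card_eq (B := A \ S) (by rw [Finset.card_sdiff_of_subset hSA, hB]),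
      ← sum_cycleSystems_fixed_eq hSA, Finset.filter_filter]
    refine Finset.sum_congr (Finset.filter_congr fun T hT => ?_) fun _ _ => rfl
    rw [hcard hT]
    exact ⟨fun h => h.2, fun h => ⟨by rw [h], h⟩⟩
  · intro T hT
    rw [Finset.mem_filter] at hT
    exact Finset.mem_powersetCard.2 ⟨Finset.filter_subset _ _, by rw [← hcard hT.1, hT.2]⟩

/-! ### From lists of cycles to sets of cycles -/

theorem coe_baseList (n : ℕ) :
    (baseList n : Multiset ℕ) = 2 • ((Finset.range n).image Nat.succ).val := by
  rw [Finset.image_val_of_injOn Nat.succ_injective.injOn]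
  induction n with
  | zero => rfl
  | succ n ih =>
    have h : baseList (n + 1) = baseList n ++ [n + 1, n + 1] := by
      simp [baseList, List.range_succ]
    rw [h, ← Multiset.coe_add, ih, Finset.range_val, Finset.range_val, Multiset.range_succ,
      Multiset.map_cons, ← Multiset.singleton_add, nsmul_add, add_comm]
    rfl

theorem pairwise_of_isStirling2 {n : ℕ} {c : List (List ℕ)} (h : IsStirling2 n c) :
    c.Pairwise (fun w₁ w₂ => w₁.headI < w₂.headI) := by
  have : IsTrans (List ℕ) (fun w₁ w₂ => w₁.headI < w₂.headI) := ⟨fun _ _ _ => lt_trans⟩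
  exact List.isChain_iff_pairwise.1 h.2.2

theorem nodup_of_isStirling2 {n : ℕ} {c : List (List ℕ)} (h : IsStirling2 n c) : c.Nodup :=
  (pairwise_of_isStirling2 h).imp fun {w₁ w₂} hlt heq => by simp [heq] at hlt

theorem coe_flatten (c : List (List ℕ)) :
    (c.flatten : Multiset ℕ) = (c.map (fun w : List ℕ => (w : Multiset ℕ))).sum := by
  induction c with
  | nil => rfl
  | cons w c ih => rw [List.flatten_cons, ← Multiset.coe_add, ih, List.map_cons, List.sum_cons]

theorem toFinset_mem_cycleSystems {n : ℕ} {c : List (List ℕ)} (h : IsStirling2 n c) :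
    c.toFinset ∈ cycleSystems ((Finset.range n).image Nat.succ) := by
  rw [mem_cycleSystems, List.sum_toFinset _ (nodup_of_isStirling2 h), ← coe_flatten,
    ← coe_baseList]
  exact ⟨fun w hw => h.2.1 w (List.mem_toFinset.1 hw), Multiset.coe_eq_coe.2 h.1⟩

theorem headI_injOn_of_mem_cycleSystems {A : Finset ℕ} {T : Finset (List ℕ)}
    (hT : T ∈ cycleSystems A) {w₁ w₂ : List ℕ} (h₁ : w₁ ∈ T) (h₂ : w₂ ∈ T)
    (h : w₁.headI = w₂.headI) : w₁ = w₂ := by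
  by_contra hne
  rw [mem_cycleSystems] at hT
  have hhead {w : List ℕ} (hw : w ∈ T) : w.count w.headI = 2 := by
    refine (hT.1 w hw).2.1 _ ?_
    obtain ⟨a, l, rfl⟩ := List.exists_cons_of_ne_nil (hT.1 w hw).1
    simp
  have hle : ((w₁ : Multiset ℕ) + (w₂ : Multiset ℕ)) ≤ 2 • A.val := by
    rw [← hT.2, ← Finset.sum_pair (f := fun w : List ℕ => (w : Multiset ℕ)) hne]
    refine Finset.sum_le_sum_of_subset ?_
    simp [Finset.insert_subset_iff, h₁, h₂]
  have hcount := Multiset.count_le_of_le w₁.headI hle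
  have hA := Multiset.nodup_iff_count_le_one.1 A.nodup w₁.headI
  rw [Multiset.count_add, Multiset.count_nsmul, Multiset.coe_count, Multiset.coe_count,
    hhead h₁, h, hhead h₂] at hcount
  rw [h] at hA
  omega

theorem exists_isStirling2_toFinset_eq {n : ℕ} {T : Finset (List ℕ)}
    (hT : T ∈ cycleSystems ((Finset.range n).image Nat.succ)) :
    ∃ c, IsStirling2 n c ∧ c.toFinset = T := by
  let r : List ℕ → List ℕ → Prop := fun w₁ w₂ => w₁.headI ≤ w₂.headI
  have : IsTrans (List ℕ) r := ⟨fun _ _ _ => le_trans⟩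
  have : Std.Total r := ⟨fun _ _ => le_total _ _⟩
  have hperm := List.perm_insertionSort r T.toList
  have hnodup : (T.toList.insertionSort r).Nodup := hperm.nodup_iff.2 T.nodup_toList
  have hmem {w : List ℕ} : w ∈ T.toList.insertionSort r ↔ w ∈ T := by simp
  have hfin : (T.toList.insertionSort r).toFinset = T := by
    ext w
    rw [List.mem_toFinset, hmem]
  refine ⟨T.toList.insertionSort r, ⟨?_, fun w hw => ?_, List.Pairwise.isChain ?_⟩, hfin⟩
  · rw [← Multiset.coe_eq_coe, coe_baseList, coe_flatten, ← List.sum_toFinset _ hnodup, hfin]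
    exact (mem_cycleSystems.1 hT).2
  · exact (mem_cycleSystems.1 hT).1 w (hmem.1 hw)
  · refine ((List.pairwise_insertionSort r T.toList).and hnodup).imp_of_mem ?_
    rintro w₁ w₂ h₁ h₂ ⟨hle, hne⟩
    exact lt_of_le_of_ne hle fun h =>
      hne (headI_injOn_of_mem_cycleSystems hT (hmem.1 h₁) (hmem.1 h₂) h)

theorem toFinset_injOn_isStirling2 {n : ℕ} {c c' : List (List ℕ)} (h : IsStirling2 n c)
    (h' : IsStirling2 n c') (heq : c.toFinset = c'.toFinset) : c = c' :=
  List.Perm.eq_of_pairwise (fun _ _ _ _ h₁ h₂ => absurd h₁ h₂.asymm)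
    (pairwise_of_isStirling2 h) (pairwise_of_isStirling2 h')
    (List.perm_of_nodup_nodup_toFinset_eq (nodup_of_isStirling2 h) (nodup_of_isStirling2 h') heq)

theorem fixSt_eq_card_filter {c : List (List ℕ)} (hc : c.Nodup) :
    fixSt c = (c.toFinset.filter IsFixedWord).card := by
  refine Finset.card_nbij (fun i => c.getD i []) ?_ ?_ ?_
  · intro i hi
    simp only [Finset.coe_filter, Finset.mem_range, Set.mem_ofPred_eq,
      List.mem_toFinset] at hi ⊢
    refine ⟨?_, hi.2⟩
    rw [List.getD_eq_getElem _ _ hi.1]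
    exact List.getElem_mem _
  · intro i hi j hj hij
    simp only [Finset.coe_filter, Finset.mem_range, Set.mem_ofPred_eq] at hi hj
    dsimp only at hij
    rw [List.getD_eq_getElem _ _ hi.1, List.getD_eq_getElem _ _ hj.1] at hij
    exact (hc.getElem_inj_iff).1 hij
  · intro w hw
    simp only [Finset.coe_filter, List.mem_toFinset, Set.mem_ofPred_eq] at hw
    obtain ⟨i, hi, rfl⟩ := List.getElem_of_mem hw.1
    refine ⟨i, ?_, List.getD_eq_getElem _ _ hi⟩
    simp only [Finset.coe_filter, Finset.mem_range, Set.mem_ofPred_eq]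
    rw [List.getD_eq_getElem _ _ hi]
    exact ⟨hi, hw.2⟩

open MvPolynomial in
theorem weight_eq_prod_cycleWeight {c : List (List ℕ)} (hc : c.Nodup) :
    (X 0 ^ capSt c * X 1 ^ cyc c : MvPolynomial (Fin 2) ℚ) =
      ∏ w ∈ c.toFinset, cycleWeight w := by
  rw [List.prod_toFinset _ hc]
  clear hc
  induction c with
  | nil => simp [capSt, cyc]
  | cons w c ih =>
    have hcap : capSt (w :: c) = capWord w + capSt c := rfl
    have hcyc : cyc (w :: c) = cyc c + 1 := rfl
    rw [List.map_cons, List.prod_cons, ← ih, hcap, hcyc, cycleWeight]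
    ring

theorem Rnk_eq_sum_cycleSystems (n k : ℕ) :
    Rnk n k = ∑ T ∈ (cycleSystems ((Finset.range n).image Nat.succ)).filter
      (fun T => (T.filter IsFixedWord).card = k), ∏ w ∈ T, cycleWeight w := by
  refine Finset.sum_bij (fun c _ => c.toFinset) ?_ ?_ ?_ ?_
  · intro c hc
    rw [Finset.mem_filter, mem_stirling2] at hc
    rw [Finset.mem_filter, ← fixSt_eq_card_filter (nodup_of_isStirling2 hc.1)]
    exact ⟨toFinset_mem_cycleSystems hc.1, hc.2⟩
  · intro c hc c' hc' h
    rw [Finset.mem_filter, mem_stirling2] at hc hc'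
    exact toFinset_injOn_isStirling2 hc.1 hc'.1 h
  · intro T hT
    rw [Finset.mem_filter] at hT
    obtain ⟨c, hc, rfl⟩ := exists_isStirling2_toFinset_eq hT.1
    refine ⟨c, ?_, rfl⟩
    rw [Finset.mem_filter, mem_stirling2, fixSt_eq_card_filter (nodup_of_isStirling2 hc)]
    exact ⟨hc, hT.2⟩
  · intro c hc
    rw [Finset.mem_filter, mem_stirling2] at hc
    exact weight_eq_prod_cycleWeight (nodup_of_isStirling2 hc.1)

theorem Rq_eq_derangementSum (n : ℕ) :
    Rq n = derangementSum ((Finset.range n).image Nat.succ) := by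
  rw [Rq, Rnk_eq_sum_cycleSystems, derangementSum]
  simp only [Finset.card_eq_zero, Finset.filter_eq_empty_iff]

open MvPolynomial in
/-- For all `0 ≤ k ≤ n`:  `R_{n,k}(x,q) = C(n,k) q^k R_{n-k}(x,q)`. -/
theorem stmt15 (n k : ℕ) (hk : k ≤ n) :
    Rnk n k = (n.choose k : MvPolynomial (Fin 2) ℚ) * X 1 ^ k * Rq (n - k) := by
  have hcard (m : ℕ) : ((Finset.range m).image Nat.succ).card = m := by
    rw [Finset.card_image_of_injective _ Nat.succ_injective, Finset.card_range]
  rw [Rnk_eq_sum_cycleSystems, Rq_eq_derangementSum,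
    sum_cycleSystems_card_fixed_eq _ _ ((Finset.range (n - k)).image Nat.succ)
      (by rw [hcard, hcard]), hcard]
end
end
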